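/- arXiv:2405.14657 — 2 statements merged into one kernel-verified Lean document; each statement's English description precedes it below -/
import Mathlib

section
/- Suppose the probability density p satisfies p(y) ≤ p_max < ∞ for all y ∈ ℝ^d, and the measurable kernel k satisfies 0 ≤ k(r) ≤ 1 for all r ∈ ℝ and ∫_{ℝ^d} k(‖u‖₂)² du < ∞; set c₁ = p_max ∫_{ℝ^d} k(‖u‖₂)² du. Then for every x ∈ ℝ^d, every bandwidth h > 0, every n ≥ 1, and every ε with 0 < ε ≤ 3c₁, the kernel density estimator satisfies P(|p̂(x) − E[p̂(x)]| > ε) ≤ 2 exp(−n h^d ε² / (4 c₁)). -/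
open MeasureTheory ProbabilityTheory Real

set_option autoImplicit false

/-- Kernel density estimator at `x` built from sample points `X` with kernel `k`
and bandwidth `h`. -/
noncomputable def kde {d : ℕ} (n : ℕ) (k : ℝ → ℝ) (h : ℝ)
    (X : Fin n → EuclideanSpace ℝ (Fin d)) (x : EuclideanSpace ℝ (Fin d)) : ℝ :=
  (1 / (n : ℝ)) * ∑ i, (1 / h ^ d) * k (‖x - X i‖ / h)

/-- The law of `n` i.i.d. samples in `ℝ^d` drawn from the density `p`:
the `n`-fold product of the measure with density `p` w.r.t. Lebesgue measure. -/
noncomputable def sampleMeasure {d : ℕ} (n : ℕ) (p : EuclideanSpace ℝ (Fin d) → ℝ) :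
    Measure (Fin n → EuclideanSpace ℝ (Fin d)) :=
  Measure.pi fun _ => MeasureTheory.volume.withDensity fun y => ENNReal.ofReal (p y)

lemma exp_le_one_add_self_add_sq {x : ℝ} (hx : x ≤ 3 / 2) : exp x ≤ 1 + x + x ^ 2 := by
  rcases le_or_gt x (-1) with h₁ | h₁
  · nlinarith [exp_le_one_iff.mpr (by linarith : x ≤ 0)]
  rcases le_or_gt x 1 with h₂ | h₂
  · linarith [le_abs_self (exp x - 1 - x),
      abs_exp_sub_one_sub_id_le (abs_le.mpr ⟨h₁.le, h₂⟩)]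
  have key := exp_bound' (x := x - 1) (by linarith) (by linarith) (n := 3) (by norm_num)
  simp only [Finset.sum_range_succ, Finset.sum_range_zero, Nat.factorial] at key
  norm_num at key
  have he := exp_one_lt_d9
  obtain ⟨y, rfl⟩ : ∃ y, x = 1 + y := ⟨x - 1, by ring⟩
  rw [add_sub_cancel_left] at key
  have hy : 0 ≤ y := by linarith
  have hy' : y ≤ 1 / 2 := by linarith
  have hcube : y ^ 3 ≤ y ^ 2 / 2 := by nlinarith [sq_nonneg y]
  rw [exp_add]
  calc exp 1 * exp y ≤ 2.72 * (1 + y + y ^ 2 * (11 / 18)) := by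
        gcongr
        · linarith
        · linarith
    _ ≤ _ := by nlinarith

section Bernstein

variable {Ω : Type*} {mΩ : MeasurableSpace Ω} {μ : Measure Ω} [IsProbabilityMeasure μ]

lemma integrable_exp_mul_of_abs_le_one {Z : Ω → ℝ} (hZ : Measurable Z)
    (hbound : ∀ ω, |Z ω| ≤ 1) (t : ℝ) : Integrable (fun ω => exp (t * Z ω)) μ :=
  integrable_exp_mul_of_mem_Icc hZ.aemeasurable (ae_of_all _ fun ω => abs_le.mp (hbound ω))

/-- A centered random variable bounded by `1` has moment generating function at most
`exp (t² v)` for `0 ≤ t ≤ 3/2`, where `v` bounds its second moment. -/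
lemma mgf_le_exp_sq_mul {Z : Ω → ℝ} (hZ : Measurable Z) (hbound : ∀ ω, |Z ω| ≤ 1)
    (hmean : ∫ ω, Z ω ∂μ = 0) {v : ℝ} (hv : ∫ ω, Z ω ^ 2 ∂μ ≤ v) {t : ℝ}
    (ht₀ : 0 ≤ t) (ht : t ≤ 3 / 2) : mgf Z μ t ≤ exp (t ^ 2 * v) := by
  have hint : Integrable Z μ :=
    Integrable.of_bound hZ.aestronglyMeasurable 1 (ae_of_all _ hbound)
  have hint2 : Integrable (fun ω => Z ω ^ 2) μ :=
    Integrable.of_bound (hZ.pow_const 2).aestronglyMeasurable 1 (ae_of_all _ fun ω => by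
      rw [norm_pow]
      exact pow_le_one₀ (norm_nonneg _) (hbound ω))
  have hlin : Integrable (fun ω => 1 + t * Z ω) μ := (integrable_const 1).add (hint.const_mul t)
  calc mgf Z μ t ≤ ∫ ω, ((1 + t * Z ω) + t ^ 2 * Z ω ^ 2) ∂μ := by
        refine integral_mono (integrable_exp_mul_of_abs_le_one hZ hbound t)
          (hlin.add (hint2.const_mul _)) fun ω => ?_
        have := exp_le_one_add_self_add_sq (x := t * Z ω)
          (by nlinarith [(abs_le.mp (hbound ω)).2])
        simpa [mul_pow] using this
    _ = 1 + t ^ 2 * ∫ ω, Z ω ^ 2 ∂μ := by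
        rw [integral_add hlin (hint2.const_mul _),
          integral_add (integrable_const 1) (hint.const_mul t), integral_const_mul,
          integral_const_mul, hmean]
        simp
    _ ≤ 1 + t ^ 2 * v := by gcongr
    _ ≤ exp (t ^ 2 * v) := by linarith [add_one_le_exp (t ^ 2 * v)]

variable {ι : Type*} [Fintype ι] {Z : ι → Ω → ℝ}

/-- One-sided Bernstein inequality in the sub-Gaussian regime. -/
lemma measureReal_sum_ge_le (hindep : iIndepFun Z μ) (hZ : ∀ i, Measurable (Z i))
    (hbound : ∀ i ω, |Z i ω| ≤ 1) (hmean : ∀ i, ∫ ω, Z i ω ∂μ = 0) {v : ℝ} (hv₀ : 0 < v)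
    (hv : ∀ i, ∫ ω, Z i ω ^ 2 ∂μ ≤ v) {s : ℝ} (hs₀ : 0 ≤ s) (hs : s ≤ 3 * v) :
    μ.real {ω | Fintype.card ι * s ≤ ∑ i, Z i ω} ≤
      exp (-(Fintype.card ι * s ^ 2) / (4 * v)) := by
  set t := s / (2 * v)
  have ht₀ : 0 ≤ t := by positivity
  have ht : t ≤ 3 / 2 := by
    rw [div_le_iff₀ (by positivity)]
    linarith
  have hchernoff := measure_ge_le_exp_mul_mgf (X := ∑ i, Z i) (μ := μ)
    (Fintype.card ι * s) ht₀ (hindep.integrable_exp_mul_sum hZ fun i _ =>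
      integrable_exp_mul_of_abs_le_one (hZ i) (hbound i) t)
  rw [hindep.mgf_sum hZ] at hchernoff
  simp only [Finset.sum_apply] at hchernoff
  calc _ ≤ exp (-t * (Fintype.card ι * s)) * ∏ i, mgf (Z i) μ t := hchernoff
    _ ≤ exp (-t * (Fintype.card ι * s)) * ∏ _i : ι, exp (t ^ 2 * v) := by
        gcongr with i
        · exact fun _ _ => mgf_nonneg
        · exact mgf_le_exp_sq_mul (hZ i) (hbound i) (hmean i) (hv i) ht₀ ht
    _ = _ := by
        rw [Finset.prod_const, Finset.card_univ, ← exp_nat_mul, ← exp_add]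
        congr 1
        simp only [t]
        field_simp
        ring

/-- Two-sided Bernstein inequality in the sub-Gaussian regime. -/
lemma measureReal_abs_sum_ge_le (hindep : iIndepFun Z μ) (hZ : ∀ i, Measurable (Z i))
    (hbound : ∀ i ω, |Z i ω| ≤ 1) (hmean : ∀ i, ∫ ω, Z i ω ∂μ = 0) {v : ℝ} (hv₀ : 0 < v)
    (hv : ∀ i, ∫ ω, Z i ω ^ 2 ∂μ ≤ v) {s : ℝ} (hs₀ : 0 ≤ s) (hs : s ≤ 3 * v) :
    μ.real {ω | Fintype.card ι * s ≤ |∑ i, Z i ω|} ≤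
      2 * exp (-(Fintype.card ι * s ^ 2) / (4 * v)) := by
  have hpos := measureReal_sum_ge_le hindep hZ hbound hmean hv₀ hv hs₀ hs
  have hneg := measureReal_sum_ge_le (Z := fun i ω => -Z i ω)
    (hindep.comp (fun _ y => -y) fun _ => measurable_neg) (fun i => (hZ i).neg)
    (fun i ω => by simpa using hbound i ω) (fun i => by simp [integral_neg, hmean i]) hv₀
    (fun i => by simpa using hv i) hs₀ hs
  have hunion : {ω | Fintype.card ι * s ≤ |∑ i, Z i ω|} =
      {ω | Fintype.card ι * s ≤ ∑ i, Z i ω} ∪ {ω | Fintype.card ι * s ≤ ∑ i, -Z i ω} := by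
    ext ω
    simp [le_abs]
  rw [hunion]
  linarith [measureReal_union_le (μ := μ) {ω | Fintype.card ι * s ≤ ∑ i, Z i ω}
    {ω | Fintype.card ι * s ≤ ∑ i, -Z i ω}]

/-- Bernstein's inequality for the empirical sums of a `[0, 1]`-valued function of i.i.d.
samples, in the sub-Gaussian regime. -/
lemma pi_real_abs_sum_sub_integral_ge_le {f : Ω → ℝ} (hf : Measurable f)
    (hf₀ : ∀ ω, 0 ≤ f ω) (hf₁ : ∀ ω, f ω ≤ 1) {v : ℝ} (hv₀ : 0 < v)
    (hv : ∫ ω, f ω ^ 2 ∂μ ≤ v) {s : ℝ} (hs₀ : 0 ≤ s) (hs : s ≤ 3 * v) :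
    (Measure.pi fun _ : ι => μ).real
        {X | Fintype.card ι * s ≤ |∑ i, (f (X i) - ∫ ω, f ω ∂μ)|} ≤
      2 * exp (-(Fintype.card ι * s ^ 2) / (4 * v)) := by
  have hint : Integrable f μ := Integrable.of_bound hf.aestronglyMeasurable 1
    (ae_of_all _ fun ω => abs_le.mpr ⟨by linarith [hf₀ ω], hf₁ ω⟩)
  set m := ∫ ω, f ω ∂μ with hm
  have hm₀ : 0 ≤ m := integral_nonneg hf₀
  have hm₁ : m ≤ 1 := by
    simpa using integral_mono hint (integrable_const (μ := μ) (1 : ℝ)) hf₁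
  have hg : Measurable fun ω => f ω - m := hf.sub_const m
  refine measureReal_abs_sum_ge_le (Z := fun i (X : ι → Ω) => f (X i) - m)
    (iIndepFun_pi (X := fun _ ω => f ω - m) fun _ => hg.aemeasurable)
    (fun i => hg.comp (measurable_pi_apply i))
    (fun i X => abs_le.mpr ⟨by linarith [hf₀ (X i)], by linarith [hf₁ (X i)]⟩)
    (fun i => ?_) hv₀ (fun i => ?_) hs₀ hs
  · rw [integral_comp_eval (μ := fun _ : ι => μ) (f := fun ω => f ω - m)
      hg.aestronglyMeasurable, integral_sub hint (integrable_const _)]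
    simp [hm]
  · rw [integral_comp_eval (μ := fun _ : ι => μ) (f := fun ω => (f ω - m) ^ 2)
      (hg.pow_const 2).aestronglyMeasurable, hm, ← variance_eq_integral hf.aemeasurable]
    exact (variance_le_expectation_sq hf.aestronglyMeasurable).trans hv

end Bernstein

section Density

variable {E : Type*} [MeasurableSpace E] {ν : Measure E} {p : E → ℝ}

lemma isProbabilityMeasure_withDensity_ofReal (hp_nonneg : ∀ y, 0 ≤ p y)
    (hp_density : ∫ y, p y ∂ν = 1) :
    IsProbabilityMeasure (ν.withDensity fun y => ENNReal.ofReal (p y)) := by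
  have hp_int : Integrable p ν := .of_integral_ne_zero (by simp [hp_density])
  constructor
  rw [withDensity_apply _ MeasurableSet.univ, Measure.restrict_univ,
    ← ofReal_integral_eq_lintegral_ofReal hp_int (ae_of_all _ hp_nonneg), hp_density,
    ENNReal.ofReal_one]

lemma integral_withDensity_ofReal_le {pmax : ℝ} (hp_meas : Measurable p)
    (hp_nonneg : ∀ y, 0 ≤ p y) (hp_le : ∀ y, p y ≤ pmax) {f : E → ℝ} (hf : Integrable f ν)
    (hf₀ : ∀ y, 0 ≤ f y) :
    ∫ y, f y ∂ν.withDensity (fun y => ENNReal.ofReal (p y)) ≤ pmax * ∫ y, f y ∂ν := by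
  rw [integral_withDensity_eq_integral_toReal_smul hp_meas.ennreal_ofReal
    (ae_of_all _ fun _ => ENNReal.ofReal_lt_top), ← integral_const_mul]
  refine integral_mono_of_nonneg
    (ae_of_all _ fun y => smul_nonneg ENNReal.toReal_nonneg (hf₀ y)) (hf.const_mul _)
    (ae_of_all _ fun y => ?_)
  simp only [ENNReal.toReal_ofReal (hp_nonneg y), smul_eq_mul]
  exact mul_le_mul_of_nonneg_right (hp_le y) (hf₀ y)

end Density

section Rescale

variable {E : Type*} [NormedAddCommGroup E] [NormedSpace ℝ E]

lemma norm_sub_div_eq (x y : E) {h : ℝ} (hh : 0 < h) : ‖x - y‖ / h = ‖h⁻¹ • (x - y)‖ := by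
  rw [norm_smul, norm_inv, norm_of_nonneg hh.le, inv_mul_eq_div]

variable [MeasurableSpace E] [BorelSpace E] [FiniteDimensional ℝ E] {ν : Measure E}
  [ν.IsAddHaarMeasure]

lemma integral_norm_sub_div (g : ℝ → ℝ) (x : E) {h : ℝ} (hh : 0 < h) :
    ∫ y, g (‖x - y‖ / h) ∂ν = h ^ Module.finrank ℝ E * ∫ u, g ‖u‖ ∂ν := by
  simp only [norm_sub_div_eq x _ hh]
  rw [integral_sub_left_eq_self (fun y => g ‖h⁻¹ • y‖),
    Measure.integral_comp_inv_smul_of_nonneg ν (fun u => g ‖u‖) hh.le, smul_eq_mul]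

lemma integrable_norm_sub_div {g : ℝ → ℝ} (hg : Integrable (fun u : E => g ‖u‖) ν) (x : E)
    {h : ℝ} (hh : 0 < h) : Integrable (fun y => g (‖x - y‖ / h)) ν := by
  simp only [norm_sub_div_eq x _ hh]
  exact (hg.comp_smul (inv_ne_zero hh.ne')).comp_sub_left x

end Rescale

/-- Bernstein-type concentration for the kernel density estimator: if `p ≤ p_max`,
`0 ≤ k ≤ 1`, and `c₁ = p_max ∫ k(‖u‖)² du`, then for `0 < ε ≤ 3c₁`,
`P(|p̂(x) − E[p̂(x)]| > ε) ≤ 2 exp(−n h^d ε² / (4c₁))`. -/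
theorem kde_concentration {d : ℕ} (hd : 1 ≤ d)
    (p : EuclideanSpace ℝ (Fin d) → ℝ) (pmax : ℝ)
    (hp_meas : Measurable p)
    (hp_nonneg : ∀ y, 0 ≤ p y) (hp_le : ∀ y, p y ≤ pmax)
    (hp_density : (∫ y, p y) = 1)
    (k : ℝ → ℝ) (hk_meas : Measurable k)
    (hk_nonneg : ∀ r, 0 ≤ k r) (hk_le_one : ∀ r, k r ≤ 1)
    (hk2 : Integrable fun u : EuclideanSpace ℝ (Fin d) => (k ‖u‖) ^ 2)
    (x : EuclideanSpace ℝ (Fin d)) (h : ℝ) (hh : 0 < h) (n : ℕ) (hn : 1 ≤ n)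
    (ε : ℝ) (hε : 0 < ε)
    (hε_le : ε ≤ 3 * (pmax * ∫ u : EuclideanSpace ℝ (Fin d), (k ‖u‖) ^ 2)) :
    sampleMeasure n p
        {X | |kde n k h X x - ∫ X', kde n k h X' x ∂sampleMeasure n p| > ε} ≤
      ENNReal.ofReal
        (2 * Real.exp (-(n * h ^ d * ε ^ 2) /
          (4 * (pmax * ∫ u : EuclideanSpace ℝ (Fin d), (k ‖u‖) ^ 2)))) := by
  set c := pmax * ∫ u : EuclideanSpace ℝ (Fin d), (k ‖u‖) ^ 2
  have hc : 0 < c := by linarith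
  have hhd : 0 < h ^ d := by positivity
  have hn₀ : (0 : ℝ) < n := by exact_mod_cast hn
  unfold sampleMeasure
  set P : Measure (EuclideanSpace ℝ (Fin d)) :=
    volume.withDensity fun y => ENNReal.ofReal (p y)
  have : IsProbabilityMeasure P := isProbabilityMeasure_withDensity_ofReal hp_nonneg hp_density
  set f : EuclideanSpace ℝ (Fin d) → ℝ := fun y => k (‖x - y‖ / h)
  have hf : Measurable f := by fun_prop
  have hf_int : Integrable f P := Integrable.of_bound hf.aestronglyMeasurable 1
    (ae_of_all _ fun y => abs_le.mpr ⟨by linarith [hk_nonneg (‖x - y‖ / h)], hk_le_one _⟩)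
  have hf_sq : ∫ y, f y ^ 2 ∂P ≤ h ^ d * c := by
    have hbound := integral_withDensity_ofReal_le hp_meas hp_nonneg hp_le
      (integrable_norm_sub_div (g := fun r => k r ^ 2) hk2 x hh) fun _ => sq_nonneg _
    rw [integral_norm_sub_div (ν := volume) (fun r => k r ^ 2) x hh,
      finrank_euclideanSpace_fin] at hbound
    exact hbound.trans_eq (mul_left_comm _ _ _)
  have hmean : ∫ X, kde n k h X x ∂(Measure.pi fun _ : Fin n => P) =
      (1 / h ^ d) * ∫ y, f y ∂P := by
    unfold kde
    rw [integral_const_mul, integral_finsetSum _ fun i _ =>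
      (integrable_comp_eval (μ := fun _ : Fin n => P) (i := i) hf_int).const_mul (1 / h ^ d)]
    simp only [integral_const_mul]
    rw [Finset.sum_congr rfl fun i _ => congrArg (1 / h ^ d * ·)
      (integral_comp_eval (μ := fun _ : Fin n => P) (i := i) hf.aestronglyMeasurable)]
    simp only [Finset.sum_const, Finset.card_univ, Fintype.card_fin, nsmul_eq_mul]
    field_simp
  have hdev : ∀ X : Fin n → EuclideanSpace ℝ (Fin d),
      kde n k h X x - (1 / h ^ d) * ∫ y, f y ∂P =
        (∑ i, (f (X i) - ∫ y, f y ∂P)) / (n * h ^ d) := by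
    intro X
    simp only [kde, ← Finset.mul_sum, Finset.sum_sub_distrib, Finset.sum_const,
      Finset.card_univ, Fintype.card_fin, nsmul_eq_mul, f]
    field_simp
  have hbernstein := pi_real_abs_sum_sub_integral_ge_le (ι := Fin n) hf (fun _ => hk_nonneg _)
    (fun _ => hk_le_one _) (mul_pos hhd hc) hf_sq (s := h ^ d * ε) (by positivity)
    (by nlinarith)
  rw [Fintype.card_fin] at hbernstein
  have hexp : -(n * (h ^ d * ε) ^ 2) / (4 * (h ^ d * c)) = -(n * h ^ d * ε ^ 2) / (4 * c) := by
    field_simp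
  rw [hexp] at hbernstein
  rw [hmean, ← ofReal_measureReal]
  refine ENNReal.ofReal_le_ofReal ((measureReal_mono fun X hX => ?_).trans hbernstein)
  rw [Set.mem_ofPred_eq, hdev, abs_div, abs_of_pos (mul_pos hn₀ hhd), gt_iff_lt,
    lt_div_iff₀ (mul_pos hn₀ hhd)] at hX
  rw [Set.mem_ofPred_eq]
  linarith
end

section
/- Suppose the probability density p satisfies p(y) ≥ 0 for all y ∈ ℝ^d, the kernel k is nonnegative, and the bias bound |E[p̂(x)] − p(x)| ≤ c₂ h^β holds for every x ∈ ℝ^d, for some constants c₂ > 0, β > 0 and bandwidth h > 0. Assume moreover that there exist constants c₃, c₄ > 0 such that for every ε > 0, P(sup_{x ∈ ℝ^d} |p̂(x) − E[p̂(x)]| > ε) ≤ c₃ exp(−c₄ n h^d ε²). Then for every scaling factor a > 0 and every δ with 0 < δ < c₃, P(sup_{x ∈ ℝ^d} |σ_ε²(x) − σ̂_ε²(x)| > a (√(log(c₃/δ) / (c₄ n h^d)) + c₂ h^β)) ≤ δ. -/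
open MeasureTheory ProbabilityTheory Real

set_option autoImplicit false

theorem kde_nonneg {d : ℕ} (n : ℕ) {k : ℝ → ℝ} (hk : ∀ r, 0 ≤ k r) {h : ℝ} (hh : 0 ≤ h)
    (X : Fin n → EuclideanSpace ℝ (Fin d)) (x : EuclideanSpace ℝ (Fin d)) :
    0 ≤ kde n k h X x :=
  mul_nonneg (by positivity)
    (Finset.sum_nonneg fun _ _ => mul_nonneg (by positivity) (hk _))

theorem exp_neg_sub_exp_neg_le {u v : ℝ} (hu : 0 ≤ u) :
    Real.exp (-u) - Real.exp (-v) ≤ |u - v| := by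
  have hv : Real.exp (-v) = Real.exp (-u) * Real.exp (u - v) := by
    rw [← Real.exp_add]; ring_nf
  have hexp := Real.add_one_le_exp (u - v)
  have hpos := Real.exp_pos (-u)
  have hone : Real.exp (-u) ≤ 1 := Real.exp_le_one_iff.mpr (by linarith)
  calc Real.exp (-u) - Real.exp (-v) = Real.exp (-u) * (1 - Real.exp (u - v)) := by
        rw [hv]; ring
    _ ≤ Real.exp (-u) * |u - v| := by
        gcongr
        linarith [neg_abs_le (u - v)]
    _ ≤ |u - v| := mul_le_of_le_one_left (abs_nonneg _) hone

theorem abs_exp_neg_sub_exp_neg_le {u v : ℝ} (hu : 0 ≤ u) (hv : 0 ≤ v) :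
    |Real.exp (-u) - Real.exp (-v)| ≤ |u - v| :=
  abs_sub_le_iff.mpr
    ⟨exp_neg_sub_exp_neg_le hu, abs_sub_comm u v ▸ exp_neg_sub_exp_neg_le hv⟩

/-- Uniform concentration of the noise-variance estimator (suprema over
`x ∈ ℝ^d` taken in `ℝ≥0∞` so that they are always well defined): assuming the
bias bound `|E[p̂(x)] − p(x)| ≤ c₂ h^β` and a Giné–Guillou-type uniform
concentration `P(sup_x |p̂(x) − E[p̂(x)]| > ε) ≤ c₃ exp(−c₄ n h^d ε²)` for all
`ε > 0`, we get, for `0 < δ < c₃`,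
`P(sup_x |σ_ε²(x) − σ̂_ε²(x)| > a (√(log(c₃/δ)/(c₄ n h^d)) + c₂ h^β)) ≤ δ`. -/
theorem noise_variance_uniform_concentration {d : ℕ} (hd : 1 ≤ d)
    (p : EuclideanSpace ℝ (Fin d) → ℝ) (hp_meas : Measurable p)
    (hp_nonneg : ∀ y, 0 ≤ p y) (hp_density : (∫ y, p y) = 1)
    (k : ℝ → ℝ) (hk_meas : Measurable k) (hk_nonneg : ∀ r, 0 ≤ k r)
    (c₂ β h : ℝ) (hc₂ : 0 < c₂) (hβ : 0 < β) (hh : 0 < h)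
    (n : ℕ) (hn : 1 ≤ n)
    (hbias : ∀ x : EuclideanSpace ℝ (Fin d),
      |(∫ X', kde n k h X' x ∂sampleMeasure n p) - p x| ≤ c₂ * h ^ β)
    (c₃ c₄ : ℝ) (hc₃ : 0 < c₃) (hc₄ : 0 < c₄)
    (hconc : ∀ ε : ℝ, 0 < ε →
      sampleMeasure n p
          {X | (⨆ x : EuclideanSpace ℝ (Fin d),
              ENNReal.ofReal
                |kde n k h X x - ∫ X', kde n k h X' x ∂sampleMeasure n p|) >
            ENNReal.ofReal ε} ≤
        ENNReal.ofReal (c₃ * Real.exp (-(c₄ * n * h ^ d * ε ^ 2))))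
    (a : ℝ) (ha : 0 < a) (δ : ℝ) (hδ0 : 0 < δ) (hδc : δ < c₃) :
    sampleMeasure n p
        {X | (⨆ x : EuclideanSpace ℝ (Fin d),
            ENNReal.ofReal
              |a * Real.exp (-(p x)) - a * Real.exp (-(kde n k h X x))|) >
          ENNReal.ofReal
            (a * (Real.sqrt (Real.log (c₃ / δ) / (c₄ * n * h ^ d)) + c₂ * h ^ β))} ≤
      ENNReal.ofReal δ := by
  have hD : 0 < c₄ * n * h ^ d := by
    have : (0 : ℝ) < n := by exact_mod_cast hn
    positivity
  have hlog : 0 < Real.log (c₃ / δ) := Real.log_pos ((one_lt_div hδ0).mpr hδc)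
  set ε := Real.sqrt (Real.log (c₃ / δ) / (c₄ * n * h ^ d)) with hε
  have hε0 : 0 < ε := Real.sqrt_pos.mpr (div_pos hlog hD)
  have htail : c₃ * Real.exp (-(c₄ * n * h ^ d * ε ^ 2)) = δ := by
    rw [hε, Real.sq_sqrt (div_pos hlog hD).le, mul_div_cancel₀ _ hD.ne', Real.exp_neg,
      Real.exp_log (div_pos hc₃ hδ0)]
    field_simp
  refine le_trans (measure_mono fun X hX => ?_) ((hconc ε hε0).trans_eq (by rw [htail]))
  simp only [Set.mem_ofPred_eq, gt_iff_lt] at hX ⊢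
  contrapose! hX
  refine iSup_le fun x => ENNReal.ofReal_le_ofReal ?_
  have hdev : |kde n k h X x - ∫ X', kde n k h X' x ∂sampleMeasure n p| ≤ ε :=
    (ENNReal.ofReal_le_ofReal_iff hε0.le).mp ((iSup_le_iff.mp hX) x)
  rw [← mul_sub, abs_mul, abs_of_pos ha]
  gcongr
  refine (abs_exp_neg_sub_exp_neg_le (hp_nonneg x) (kde_nonneg n hk_nonneg hh.le X x)).trans ?_
  rw [abs_sub_comm]
  exact (abs_sub_le _ _ _).trans (add_le_add hdev (hbias x))
end
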